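/- Suppose n ≥ 16. Let S be a 2-factor of G that is not a tour, containing the path P = {(v1,v2), (v2,v3), (v3,v4)} (v1, v2, v3, v4 distinct) in a cycle C* of S; let C** be a cycle of S distinct from C*; let T be a path cover of G with (v1,v2), (v2,v3) ∈ T and V1(T) = V \ {v2}; and let f ∈ C** \ T be an edge with endpoint q such that T ∪ {f} is a path cover of G. Then there exist four path covers S1, S2, T1, T2 of G with S_i ∪ T_i = S ∪ T and S_i ∩ T_i = S ∩ T for i = 1,2, and pairwise disjoint edge sets A1, A2, B1, B2 ⊆ E, each disjoint from the corresponding path cover, such that: S_i ∪ A_i and T_i ∪ B_i are tours of G for i = 1,2; the union C = A1 ∪ A2 ∪ B1 ∪ B2 consists of either one or two cycles and satisfies V(C) = V \ {v2}; and there exists a cycle D with vertex set V \ {v2} such that (q, v3) ∈ D and ℓ(D) ≥ ℓ(C). -/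

import Mathlib

variable {V : Type*} [Fintype V] [DecidableEq V]

/-- The degree of vertex `v` in the edge set `F`. -/
def degE (F : Finset (Sym2 V)) (v : V) : ℕ := (F.filter (fun e => v ∈ e)).card

/-- The set of vertices incident to an edge of `F`. -/
def VsetE (F : Finset (Sym2 V)) : Set V := {v | ∃ e ∈ F, v ∈ e}

/-- Vertices incident to exactly one edge of `F`. -/
def V1E (F : Finset (Sym2 V)) : Set V := {v | degE F v = 1}

/-- Vertices incident to exactly two edges of `F`. -/
def V2E (F : Finset (Sym2 V)) : Set V := {v | degE F v = 2}

/-- All edges are genuine edges of the complete graph (no loops). -/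
def SimpleE (F : Finset (Sym2 V)) : Prop := ∀ e ∈ F, ¬ e.IsDiag

/-- `F` is spanning: every vertex is incident to an edge of `F`. -/
def SpanningE (F : Finset (Sym2 V)) : Prop := VsetE F = Set.univ

/-- `F` is a `k`-matching: every vertex has at most `k` incident edges. -/
def IsKMatching (k : ℕ) (F : Finset (Sym2 V)) : Prop :=
  SimpleE F ∧ ∀ v : V, degE F v ≤ k

/-- `F` is a `k`-factor: every vertex has exactly `k` incident edges. -/
def IsKFactor (k : ℕ) (F : Finset (Sym2 V)) : Prop :=
  SimpleE F ∧ ∀ v : V, degE F v = k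

/-- `F` is the edge set of a single (simple) cycle. -/
def IsCycleE (F : Finset (Sym2 V)) : Prop :=
  ∃ m : ℕ, 3 ≤ m ∧ ∃ f : ℕ → V,
    (∀ i < m, ∀ j < m, f i = f j → i = j) ∧
    F = (Finset.range m).image (fun i => s(f i, f ((i + 1) % m)))

/-- `F` contains no cycle. -/
def AcyclicE (F : Finset (Sym2 V)) : Prop :=
  ∀ C : Finset (Sym2 V), C ⊆ F → ¬ IsCycleE C

/-- `F` is the edge set of a simple path with endpoints `a` and `b`. -/
def IsPathE (F : Finset (Sym2 V)) (a b : V) : Prop :=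
  ∃ m : ℕ, 1 ≤ m ∧ ∃ f : ℕ → V,
    (∀ i ≤ m, ∀ j ≤ m, f i = f j → i = j) ∧ f 0 = a ∧ f m = b ∧
    F = (Finset.range m).image (fun i => s(f i, f (i + 1)))

/-- `P` is a maximal path of `F`, i.e. `P ∈ 𝒫(F)`. -/
def MaxPathE (F P : Finset (Sym2 V)) : Prop :=
  P ⊆ F ∧ (∃ a b : V, IsPathE P a b) ∧
  ∀ e ∈ F, (∃ v : V, v ∈ e ∧ v ∈ VsetE P) → e ∈ P

/-- `F` is a path cover: a spanning acyclic 2-matching. -/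
def IsPathCoverE (F : Finset (Sym2 V)) : Prop :=
  IsKMatching 2 F ∧ SpanningE F ∧ AcyclicE F

/-- `F` is a tour: the edge set of a Hamiltonian cycle. -/
def IsTourE (F : Finset (Sym2 V)) : Prop :=
  IsCycleE F ∧ SpanningE F

/-- Total length of the edge set `F`. -/
def lenE (ℓ : Sym2 V → ℝ) (F : Finset (Sym2 V)) : ℝ := ∑ e ∈ F, ℓ e

/-- Minimum length of a tour. -/
noncomputable def optE (ℓ : Sym2 V → ℝ) : ℝ :=
  sInf {x | ∃ H : Finset (Sym2 V), IsTourE H ∧ lenE ℓ H = x}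

/-- Maximum length of a tour. -/
noncomputable def worE (ℓ : Sym2 V → ℝ) : ℝ :=
  sSup {x | ∃ H : Finset (Sym2 V), IsTourE H ∧ lenE ℓ H = x}

/-- The set of edges of `F` incident to `v`. -/
def deltaE (F : Finset (Sym2 V)) (v : V) : Finset (Sym2 V) :=
  F.filter (fun e => v ∈ e)

/-- `(S, T)` is a valid pair of spanning 2-matchings. -/
def ValidPairE (S T : Finset (Sym2 V)) : Prop :=
  IsKMatching 2 S ∧ IsKMatching 2 T ∧ SpanningE S ∧ SpanningE T ∧
  AcyclicE T ∧
  (∀ v : V, v ∈ V2E S → v ∈ V2E T → deltaE S v = deltaE T v) ∧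
  (∀ C : Finset (Sym2 V), C ⊆ S → IsCycleE C →
    ∀ P : Finset (Sym2 V), MaxPathE T P → VsetE C ≠ VsetE P)

section

set_option linter.unusedSectionVars false

variable {F D E P Q : Finset (Sym2 V)} {a b c d v : V} {e : Sym2 V}

lemma degE_insert (h : e ∉ F) (v : V) :
    degE (insert e F) v = degE F v + if v ∈ e then 1 else 0 := by
  unfold degE
  rw [Finset.filter_insert]
  split_ifs with hv
  · rw [Finset.card_insert_of_notMem (by simp [h])]
  · rfl

lemma degE_erase_add (h : e ∈ F) (v : V) :
    degE (F.erase e) v + (if v ∈ e then 1 else 0) = degE F v := by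
  rw [← degE_insert (Finset.notMem_erase e F), Finset.insert_erase h]

lemma degE_union (h : Disjoint E F) (v : V) : degE (E ∪ F) v = degE E v + degE F v := by
  unfold degE
  rw [Finset.filter_union, Finset.card_union_of_disjoint (Finset.disjoint_filter_filter h)]

lemma degE_sdiff_add (h : E ⊆ F) (v : V) : degE (F \ E) v + degE E v = degE F v := by
  rw [← degE_union Finset.sdiff_disjoint, Finset.sdiff_union_of_subset h]

lemma degE_mono (h : E ⊆ F) (v : V) : degE E v ≤ degE F v :=
  Finset.card_le_card (Finset.filter_subset_filter _ h)

lemma degE_pos : 0 < degE F v ↔ ∃ e ∈ F, v ∈ e := by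
  simp [degE, Finset.card_pos, Finset.Nonempty]

lemma degE_eq_zero : degE F v = 0 ↔ ∀ e ∈ F, v ∉ e := by
  simp [degE, Finset.filter_eq_empty_iff]

lemma eq_empty_of_degE (h : ∀ v, degE F v = 0) : F = ∅ := by
  rw [Finset.eq_empty_iff_forall_notMem]
  intro e he
  induction e with
  | h a b => exact degE_eq_zero.1 (h a) _ he (Sym2.mem_mk_left a b)

/-- A subset attaining the full degree at `v` contains all edges at `v`. -/
lemma mem_of_degE_eq (h : D ⊆ P) (hd : degE P v ≤ degE D v) (he : e ∈ P) (hv : v ∈ e) : e ∈ D := by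
  have := Finset.eq_of_subset_of_card_le (Finset.filter_subset_filter (fun e => v ∈ e) h) hd
  have h2 : e ∈ P.filter (fun e => v ∈ e) := by simp [he, hv]
  rw [← this] at h2
  exact (Finset.mem_filter.1 h2).1

lemma degE_inter_of_degE_eq (h : D ⊆ P) (hE : E ⊆ P) (hd : degE P v ≤ degE D v) :
    degE (D ∩ E) v = degE E v := by
  unfold degE
  congr 1
  ext e
  simp only [Finset.mem_filter, Finset.mem_inter]
  exact ⟨fun h => ⟨h.1.2, h.2⟩, fun h' => ⟨⟨mem_of_degE_eq h hd (hE h'.1) h'.2, h'.1⟩, h'.2⟩⟩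

lemma SimpleE.mono (h : SimpleE F) (hE : E ⊆ F) : SimpleE E := fun e he => h e (hE he)

lemma sum_degE (h : SimpleE F) : ∑ v, degE F v = 2 * F.card := by
  unfold degE
  simp_rw [Finset.card_filter]
  rw [Finset.sum_comm, mul_comm, ← smul_eq_mul, ← Finset.sum_const]
  refine Finset.sum_congr rfl fun e he => ?_
  rw [← Sym2.card_toFinset_of_not_isDiag e (h e he), ← Finset.card_filter]
  congr 1
  ext v
  simp

/-- The number of odd vertices is not one. -/
lemma even_degE_of_forall_ne (h : SimpleE F) (ha : ∀ v, v ≠ a → Even (degE F v)) :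
    Even (degE F a) := by
  have h1 := sum_degE h
  rw [← Finset.add_sum_erase _ _ (Finset.mem_univ a)] at h1
  have h2 : Even (∑ v ∈ Finset.univ.erase a, degE F v) :=
    Finset.even_sum _ fun v hv => ha v (Finset.ne_of_mem_erase hv)
  have h3 : Even (degE F a + ∑ v ∈ Finset.univ.erase a, degE F v) := h1 ▸ even_two_mul _
  exact (Nat.even_add.1 h3).2 h2

/-- Every vertex has degree zero or two. -/
def IsTwoRegularE (F : Finset (Sym2 V)) : Prop := ∀ v, degE F v = 0 ∨ degE F v = 2

/-- `D` has odd degree exactly at the two distinct vertices `a` and `b`, where the degree is one. -/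
def JoinsE (D : Finset (Sym2 V)) (a b : V) : Prop :=
  a ≠ b ∧ degE D a = 1 ∧ degE D b = 1 ∧ ∀ v, v ≠ a → v ≠ b → degE D v = 0 ∨ degE D v = 2

/-- The edge set `P` contains a subset joining `a` and `b`. -/
def ConnE (P : Finset (Sym2 V)) (a b : V) : Prop := ∃ D ⊆ P, JoinsE D a b

/-- A linear forest: an acyclic 2-matching. -/
def IsLinearForestE (P : Finset (Sym2 V)) : Prop := IsKMatching 2 P ∧ AcyclicE P

lemma ConnE.symm (h : ConnE P a b) : ConnE P b a := by
  obtain ⟨D, hD, h1, h2, h3, h4⟩ := h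
  exact ⟨D, hD, h1.symm, h3, h2, fun v hv hv' => h4 v hv' hv⟩

lemma ConnE.ne (h : ConnE P a b) : a ≠ b := h.choose_spec.2.1

lemma ConnE.mono (h : ConnE P a b) (hPQ : P ⊆ Q) : ConnE Q a b := by
  obtain ⟨D, hD, h⟩ := h
  exact ⟨D, hD.trans hPQ, h⟩

lemma degE_singleton (e : Sym2 V) (v : V) : degE {e} v = if v ∈ e then 1 else 0 := by
  rw [← insert_empty_eq, degE_insert (by simp)]
  simp [degE]

lemma joinsE_singleton (h : a ≠ b) : JoinsE {s(a, b)} a b := by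
  refine ⟨h, ?_, ?_, fun v h1 h2 => Or.inl ?_⟩ <;> simp [degE_singleton, *]

lemma connE_of_mem (h : a ≠ b) (he : s(a, b) ∈ P) : ConnE P a b :=
  ⟨{s(a, b)}, by simpa using he, joinsE_singleton h⟩

lemma ConnE.unique (hP : IsKMatching 2 P) (ha : degE P a = 1) (hb : degE P b = 1)
    (hc : degE P c = 1) (h : ConnE P a b) (h' : ConnE P a c) : b = c := by
  by_contra hbc
  obtain ⟨D, hD, hab, hDa, hDb, hD'⟩ := h
  obtain ⟨E, hE, hac, hEa, hEc, hE'⟩ := h'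
  have key := even_degE_of_forall_ne (F := D ∩ E) (a := a)
    (hP.1.mono (Finset.inter_subset_left.trans hD)) ?_
  · rw [degE_inter_of_degE_eq hD hE (by lia), hEa] at key
    exact absurd key (by decide)
  · intro v hv
    by_cases hvb : v = b
    · subst hvb
      have h1 := degE_mono hE v
      have h2 := hE' v hv hbc
      have h3 := degE_mono (E := D ∩ E) (F := E) Finset.inter_subset_right v
      have : degE (D ∩ E) v = 0 := by lia
      simp [this]
    · have h1 := hP.2 v
      rcases hD' v hv hvb with h2 | h2
      · have h3 := degE_mono (E := D ∩ E) (F := D) Finset.inter_subset_left v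
        have : degE (D ∩ E) v = 0 := by lia
        simp [this]
      · rw [degE_inter_of_degE_eq hD hE (by lia)]
        by_cases hvc : v = c
        · subst hvc
          have h3 := degE_mono hD v
          lia
        · rcases hE' v hv hvc with h3 | h3 <;> simp [h3]

lemma IsKMatching.mono {k : ℕ} (h : IsKMatching k P) (hD : D ⊆ P) : IsKMatching k D :=
  ⟨h.1.mono hD, fun v => (degE_mono hD v).trans (h.2 v)⟩

lemma exists_isPathE (hP : IsKMatching 2 P) (ha : degE P a = 1) :
    ∃ b, degE P b = 1 ∧ ∃ D ⊆ P, JoinsE D a b ∧ IsPathE D a b := by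
  induction hn : P.card generalizing P a with
  | zero =>
    rw [Finset.card_eq_zero] at hn
    simp [hn, degE] at ha
  | succ n ih =>
    obtain ⟨e, he, hae⟩ := degE_pos.1 (show 0 < degE P a by lia)
    obtain ⟨c, rfl⟩ := hae
    have hac : a ≠ c := fun h => hP.1 _ he (by simpa using h)
    have hdeg := degE_erase_add he
    have hda := hdeg a
    have hdc := hdeg c
    simp only [Sym2.mem_iff, true_or, or_true, if_true] at hda hdc
    by_cases hc : degE P c = 1
    · refine ⟨c, hc, {s(a, c)}, by simpa using he, joinsE_singleton hac, 1, le_rfl,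
        fun i => if i = 0 then a else c, ?_, by simp, by simp, by simp⟩
      intro i hi j hj
      interval_cases i <;> interval_cases j <;> simp [hac, hac.symm]
    · have h2 := hP.2 c
      obtain ⟨b, hb, D, hD, ⟨hcb, hDc, hDb, hD'⟩, m, hm, f, hinj, h0, hfm, hDf⟩ :=
        ih (hP.mono (Finset.erase_subset s(a, c) P)) (a := c) (by lia)
          (by rw [Finset.card_erase_of_mem he, hn]; rfl)
      have hab : a ≠ b := by rintro rfl; lia
      have hDa : degE D a = 0 := by have := degE_mono hD a; lia
      have heD : s(a, c) ∉ D := fun h => Finset.notMem_erase _ _ (hD h)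
      have hbP := hdeg b
      simp only [Sym2.mem_iff, hab.symm, hcb.symm, or_self, if_false] at hbP
      refine ⟨b, by lia, insert s(a, c) D,
        Finset.insert_subset he (hD.trans (Finset.erase_subset _ _)),
        ⟨hab, ?_, ?_, fun v hva hvb => ?_⟩, m + 1, by lia,
        fun i => if i = 0 then a else f (i - 1), ?_, by simp, by simp [hfm], ?_⟩
      · simp [degE_insert heD, hDa]
      · simp [degE_insert heD, hDb, hab.symm, hcb.symm]
      · rw [degE_insert heD]
        by_cases hvc : v = c
        · simp [hvc, hDc]
        · simpa [hva, hvc] using hD' v hvc hvb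
      · have hnot : ∀ i ≤ m, f i ≠ a := by
          intro i hi hfi
          refine degE_eq_zero.1 hDa (if i = 0 then s(f 0, f 1) else s(f (i - 1), f (i - 1 + 1))) ?_ ?_
          · rw [hDf, Finset.mem_image]
            split_ifs
            · exact ⟨0, by simp; lia, rfl⟩
            · exact ⟨i - 1, by simp; lia, rfl⟩
          · split_ifs with h
            · subst h; simp [hfi]
            · rw [Nat.sub_add_cancel (by lia), hfi]; simp
        intro i hi j hj
        rcases i with _ | i <;> rcases j with _ | j
        · simp
        · intro h; exact absurd h.symm (by simpa using hnot j (by lia))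
        · intro h; exact absurd h (by simpa using hnot i (by lia))
        · intro h
          have := hinj i (by lia) j (by lia) (by simpa using h)
          lia
      · rw [Finset.range_add_one', Finset.image_insert, hDf, Finset.map_eq_image, Finset.image_image]
        simp only [if_true, zero_add, Nat.add_eq_zero_iff, one_ne_zero, and_false, if_false,
          Nat.sub_self, h0]
        rfl

lemma exists_connE (hP : IsKMatching 2 P) (ha : degE P a = 1) :
    ∃ b, degE P b = 1 ∧ ConnE P a b := by
  obtain ⟨b, hb, D, hD, h, -⟩ := exists_isPathE hP ha
  exact ⟨b, hb, D, hD, h⟩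

lemma IsTwoRegularE.exists_isCycleE (hs : SimpleE F) (h : IsTwoRegularE F) (hne : F.Nonempty) :
    ∃ C ⊆ F, IsCycleE C := by
  obtain ⟨e, he⟩ := hne
  induction e with
  | h a b =>
  have hab : a ≠ b := fun h => hs _ he (by simpa using h)
  have hdeg := degE_erase_add he
  have hm : IsKMatching 2 (F.erase s(a, b)) :=
    IsKMatching.mono ⟨hs, fun v => by have := h v; lia⟩ (Finset.erase_subset _ _)
  have hone : ∀ v, degE (F.erase s(a, b)) v = 1 ↔ v = a ∨ v = b := by
    intro v
    have h1 := hdeg v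
    have h2 := h v
    simp only [Sym2.mem_iff] at h1
    split_ifs at h1 with h3
    · simp only [h3, iff_true]; lia
    · simp only [h3, iff_false]; lia
  obtain ⟨c, hc, D, hD, hJ, m, hm1, f, hinj, h0, hfm, hDf⟩ :=
    exists_isPathE hm ((hone a).2 (Or.inl rfl))
  obtain rfl : c = b := ((hone c).1 hc).resolve_left hJ.1.symm
  have heD : s(a, c) ∉ D := fun h => Finset.notMem_erase _ _ (hD h)
  refine ⟨insert s(a, c) D, Finset.insert_subset he (hD.trans (Finset.erase_subset _ _)),
    m + 1, ?_, f, fun i hi j hj => hinj i (by lia) j (by lia), ?_⟩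
  · by_contra hlt
    obtain rfl : m = 1 := by lia
    apply heD
    rw [hDf]
    simp [h0, hfm]
  · rw [Finset.range_add_one, Finset.image_insert, hDf]
    congr 1
    · simp [h0, hfm, Sym2.eq_swap]
    · refine Finset.image_congr fun i hi => ?_
      have : i + 1 < m + 1 := by simpa using hi
      simp only [Nat.mod_eq_of_lt this]

lemma degE_image_cycle {m : ℕ} (hm : 3 ≤ m) {f : ℕ → V}
    (hinj : ∀ i < m, ∀ j < m, f i = f j → i = j) {j : ℕ} (hj : j < m) :
    degE ((Finset.range m).image (fun i => s(f i, f ((i + 1) % m)))) (f j) = 2 := by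
  have hmod : ∀ i < m, (i + 1) % m = if i + 1 = m then 0 else i + 1 := by
    intro i hi
    split_ifs with h
    · rw [h, Nat.mod_self]
    · exact Nat.mod_eq_of_lt (by lia)
  have hmodlt : ∀ i, (i + 1) % m < m := fun i => Nat.mod_lt _ (by lia)
  set p := if j = 0 then m - 1 else j - 1 with hp
  have hpm : p < m := by rw [hp]; split_ifs <;> lia
  have hps : (p + 1) % m = j := by
    rw [hmod p hpm, hp]
    split_ifs <;> lia
  have hpj : p ≠ j := by rw [hp]; split_ifs <;> lia
  have key : ((Finset.range m).image (fun i => s(f i, f ((i + 1) % m)))).filter (fun e => f j ∈ e)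
      = {s(f j, f ((j + 1) % m)), s(f p, f ((p + 1) % m))} := by
    ext e
    simp only [Finset.mem_filter, Finset.mem_image, Finset.mem_range, Finset.mem_insert,
      Finset.mem_singleton]
    constructor
    · rintro ⟨⟨i, hi, rfl⟩, hje⟩
      rcases Sym2.mem_iff.1 hje with h | h
      · rw [hinj _ hj _ hi h]; exact Or.inl rfl
      · right
        have h2 := hinj _ hj _ (hmodlt i) h
        have h3 : i = p := by
          rw [hmod i hi] at h2
          rw [hp]
          split_ifs at h2 ⊢ <;> lia
        rw [h3]
    · rintro (rfl | rfl)
      · exact ⟨⟨j, hj, rfl⟩, by simp⟩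
      · exact ⟨⟨p, hpm, rfl⟩, by simp [hps]⟩
  unfold degE
  rw [key, Finset.card_pair]
  rw [hps]
  intro h
  rcases Sym2.eq_iff.1 h with ⟨h1, -⟩ | ⟨-, h1⟩
  · exact hpj (hinj _ hj _ hpm h1).symm
  · have h2 := hinj _ (hmodlt j) _ hpm h1
    rw [hmod j hj] at h2
    rw [hp] at h2
    split_ifs at h2 <;> lia

lemma IsCycleE.isTwoRegularE (h : IsCycleE F) : IsTwoRegularE F := by
  obtain ⟨m, hm, f, hinj, rfl⟩ := h
  intro v
  by_cases hv : ∃ j < m, f j = v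
  · obtain ⟨j, hj, rfl⟩ := hv
    exact Or.inr (degE_image_cycle hm hinj hj)
  · left
    rw [degE_eq_zero]
    intro e he hve
    obtain ⟨i, hi, rfl⟩ := Finset.mem_image.1 he
    rw [Finset.mem_range] at hi
    rcases Sym2.mem_iff.1 hve with rfl | rfl
    · exact hv ⟨i, hi, rfl⟩
    · exact hv ⟨_, Nat.mod_lt _ (by lia), rfl⟩

lemma IsCycleE.nonempty (h : IsCycleE F) : F.Nonempty := by
  obtain ⟨m, hm, f, hinj, rfl⟩ := h
  exact ⟨_, Finset.mem_image_of_mem _ (Finset.mem_range.2 (show 0 < m by lia))⟩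

/-- A nonempty two-regular subset of a cycle is the whole cycle. -/
lemma IsCycleE.eq_of_subset (h : IsCycleE F) (hDF : D ⊆ F) (hD : IsTwoRegularE D)
    (hne : D.Nonempty) : D = F := by
  have hF := h.isTwoRegularE
  obtain ⟨m, hm, f, hinj, rfl⟩ := h
  set g : ℕ → Sym2 V := fun i => s(f i, f ((i + 1) % m)) with hg
  have hstep : ∀ i < m, g i ∈ D → g ((i + 1) % m) ∈ D := by
    intro i hi hgi
    have hlt : (i + 1) % m < m := Nat.mod_lt _ (by lia)
    have hpos : 0 < degE D (f ((i + 1) % m)) := degE_pos.2 ⟨_, hgi, by simp [hg]⟩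
    refine mem_of_degE_eq hDF (v := f ((i + 1) % m)) ?_
      (Finset.mem_image_of_mem _ (Finset.mem_range.2 hlt)) (by simp [hg])
    have h1 := hD (f ((i + 1) % m))
    have h2 := hF (f ((i + 1) % m))
    lia
  obtain ⟨e, he⟩ := hne
  obtain ⟨i, hi, rfl⟩ := Finset.mem_image.1 (hDF he)
  rw [Finset.mem_range] at hi
  have hall : ∀ k, g ((i + k) % m) ∈ D := by
    intro k
    induction k with
    | zero => rwa [add_zero, Nat.mod_eq_of_lt hi]
    | succ k ih =>
      have := hstep _ (Nat.mod_lt _ (by lia)) ih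
      rwa [Nat.mod_add_mod] at this
  refine Finset.Subset.antisymm hDF fun e he' => ?_
  obtain ⟨j, hj, rfl⟩ := Finset.mem_image.1 he'
  rw [Finset.mem_range] at hj
  have := hall (m - i + j)
  rwa [show i + (m - i + j) = j + m by lia, Nat.add_mod_right, Nat.mod_eq_of_lt hj] at this

lemma AcyclicE.eq_empty (h : AcyclicE F) (hs : SimpleE F) (hD : D ⊆ F) (h2 : IsTwoRegularE D) :
    D = ∅ := by
  by_contra hne
  obtain ⟨C, hC, hcyc⟩ :=
    h2.exists_isCycleE (hs.mono hD) (Finset.nonempty_iff_ne_empty.2 hne)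
  exact h C (hC.trans hD) hcyc

lemma SimpleE.insert_edge (h : SimpleE F) (hab : a ≠ b) : SimpleE (insert s(a, b) F) := by
  intro e he
  rcases Finset.mem_insert.1 he with rfl | he
  · simpa using hab
  · exact h e he

lemma IsLinearForestE.insert_edge (hP : IsLinearForestE P) (hab : a ≠ b) (ha : degE P a = 1)
    (hb : degE P b = 1) (h : ¬ ConnE P a b) : IsLinearForestE (insert s(a, b) P) := by
  have he : s(a, b) ∉ P := fun he => h (connE_of_mem hab he)
  refine ⟨⟨hP.1.1.insert_edge hab, fun v => ?_⟩, fun C hC hcyc => ?_⟩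
  · rw [degE_insert he]
    have := hP.1.2 v
    split_ifs with hv
    · rcases Sym2.mem_iff.1 hv with rfl | rfl <;> lia
    · lia
  · by_cases heC : s(a, b) ∈ C
    · refine h ⟨C.erase s(a, b), Finset.subset_insert_iff.1 hC, hab, ?_, ?_, fun v hva hvb => ?_⟩
      · have h1 := degE_erase_add heC a
        have h2 := hcyc.isTwoRegularE a
        simp only [Sym2.mem_mk_left, if_true] at h1
        lia
      · have h1 := degE_erase_add heC b
        have h2 := hcyc.isTwoRegularE b
        simp only [Sym2.mem_mk_right, if_true] at h1
        lia
      · have h1 := degE_erase_add heC v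
        have h2 := hcyc.isTwoRegularE v
        simp only [Sym2.mem_iff, hva, hvb, or_self, if_false] at h1
        lia
    · exact hP.2 C ((Finset.subset_insert_iff_of_notMem heC).1 hC) hcyc

lemma degE_insert_endpoints (h : s(a, b) ∉ P) (v : V) :
    degE (insert s(a, b) P) v = degE P v + if v = a ∨ v = b then 1 else 0 := by
  rw [degE_insert h]
  simp only [Sym2.mem_iff]

lemma IsLinearForestE.isCycleE_insert (hP : IsLinearForestE P) (hab : a ≠ b)
    (h1 : ∀ v, degE P v = 1 ↔ v = a ∨ v = b) (hcard : 2 ≤ P.card) :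
    s(a, b) ∉ P ∧ IsCycleE (insert s(a, b) P) := by
  have he : s(a, b) ∉ P := by
    intro he
    have h2 : P.erase s(a, b) = ∅ := by
      refine hP.2.eq_empty hP.1.1 (Finset.erase_subset _ _) fun v => ?_
      have h3 := degE_erase_add he v
      have h4 := h1 v
      have h5 := hP.1.2 v
      simp only [Sym2.mem_iff] at h3
      split_ifs at h3 with h <;> simp only [h, iff_true, iff_false] at h4 <;> lia
    have h3 := Finset.card_erase_of_mem he
    rw [h2, Finset.card_empty] at h3
    lia
  refine ⟨he, ?_⟩
  have hdeg : IsTwoRegularE (insert s(a, b) P) := by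
    intro v
    rw [degE_insert_endpoints he]
    have h4 := h1 v
    have h5 := hP.1.2 v
    split_ifs with h <;> simp only [h, iff_true, iff_false] at h4 <;> lia
  have hs := hP.1.1.insert_edge hab
  obtain ⟨C, hC, hcyc⟩ := hdeg.exists_isCycleE hs ⟨_, Finset.mem_insert_self _ _⟩
  have heC : s(a, b) ∈ C := by
    by_contra heC
    exact hP.2 C ((Finset.subset_insert_iff_of_notMem heC).1 hC) hcyc
  have hrest : insert s(a, b) P \ C = ∅ := by
    refine hP.2.eq_empty hP.1.1 ?_ fun v => ?_
    · intro e he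
      rw [Finset.mem_sdiff, Finset.mem_insert] at he
      exact he.1.resolve_left fun h => he.2 (h ▸ heC)
    · have h2 := degE_sdiff_add hC v
      have h3 := hdeg v
      have h4 := hcyc.isTwoRegularE v
      have h5 := degE_mono hC v
      lia
  rwa [Finset.Subset.antisymm (Finset.sdiff_eq_empty_iff_subset.1 hrest) hC]

lemma ConnE.of_insert (hP : IsKMatching 2 P) (ha : degE P a = 1)
    (hb : degE P b = 1) (hc : degE P c = 1) (hd : degE P d = 1) (hac : a ≠ c) (had : a ≠ d)
    (hbc : b ≠ c) (hbd : b ≠ d) (h : ConnE (insert s(a, b) P) c d) :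
    ConnE P c d ∨ (ConnE P c a ∧ ConnE P d b) ∨ (ConnE P c b ∧ ConnE P d a) := by
  obtain ⟨D, hD, hJ⟩ := h
  by_cases he : s(a, b) ∈ D
  swap
  · exact Or.inl ⟨D, (Finset.subset_insert_iff_of_notMem he).1 hD, hJ⟩
  obtain ⟨hcd, hDc, hDd, hD'⟩ := hJ
  set E := D.erase s(a, b) with hE
  have hEP : E ⊆ P := Finset.subset_insert_iff.1 hD
  have hdeg := degE_erase_add he
  rw [← hE] at hdeg
  simp only [Sym2.mem_iff] at hdeg
  have h1 : ∀ v, degE E v = 1 → v = a ∨ v = b ∨ v = c ∨ v = d := by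
    intro v hv
    by_contra! hcon
    have h2 := hD' v hcon.2.2.1 hcon.2.2.2
    have h3 := hdeg v
    simp only [hcon.1, hcon.2.1, or_self, if_false] at h3
    lia
  have hEc : degE E c = 1 := by
    have := hdeg c
    simp only [hac.symm, hbc.symm, or_self, if_false] at this
    lia
  have hEd : degE E d = 1 := by
    have := hdeg d
    simp only [had.symm, hbd.symm, or_self, if_false] at this
    lia
  obtain ⟨z, hz, hcz⟩ := exists_connE (hP.mono hEP) hEc
  obtain ⟨w, hw, hdw⟩ := exists_connE (hP.mono hEP) hEd
  replace hcz := hcz.mono hEP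
  replace hdw := hdw.mono hEP
  rcases h1 z hz with rfl | rfl | rfl | rfl
  · rcases h1 w hw with rfl | rfl | rfl | rfl
    · exact absurd (ConnE.unique hP ha hc hd hcz.symm hdw.symm) hcd
    · exact Or.inr (Or.inl ⟨hcz, hdw⟩)
    · exact Or.inl hdw.symm
    · exact absurd rfl hdw.ne
  · rcases h1 w hw with rfl | rfl | rfl | rfl
    · exact Or.inr (Or.inr ⟨hcz, hdw⟩)
    · exact absurd (ConnE.unique hP hb hc hd hcz.symm hdw.symm) hcd
    · exact Or.inl hdw.symm
    · exact absurd rfl hdw.ne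
  · exact absurd rfl hcz.ne
  · exact Or.inl hcz

/-- The vertices of degree one. -/
def endsE (P : Finset (Sym2 V)) : Finset V := Finset.univ.filter fun v => degE P v = 1

lemma mem_endsE : v ∈ endsE P ↔ degE P v = 1 := by simp [endsE]

lemma degE_insert_eq_one_iff (ha : degE P a = 1) (hb : degE P b = 1) (h : s(a, b) ∉ P) (v : V) :
    degE (insert s(a, b) P) v = 1 ↔ degE P v = 1 ∧ v ≠ a ∧ v ≠ b := by
  rw [degE_insert_endpoints h]
  by_cases hv : v = a ∨ v = b
  · rcases hv with rfl | rfl <;> simp [*]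
  · simp only [hv, if_false, add_zero]
    tauto

lemma card_endsE_insert_lt (ha : degE P a = 1) (hb : degE P b = 1) (h : s(a, b) ∉ P) :
    (endsE (insert s(a, b) P)).card < (endsE P).card := by
  refine Finset.card_lt_card ⟨fun v hv => ?_, fun hsub => ?_⟩
  · rw [mem_endsE, degE_insert_eq_one_iff ha hb h] at hv
    exact mem_endsE.2 hv.1
  · have := hsub (mem_endsE.2 ha)
    simp [mem_endsE, degE_insert_eq_one_iff ha hb h] at this

lemma degE_insert_completion (ha : degE P a = 1) (hb : degE P b = 1) (h : s(a, b) ∉ P)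
    (hdisj : Disjoint (insert s(a, b) P) D)
    (hD : ∀ v, degE D v = if degE (insert s(a, b) P) v = 1 then 1 else 0) (v : V) :
    degE (insert s(a, b) D) v = if degE P v = 1 then 1 else 0 := by
  rw [degE_insert_endpoints (Finset.disjoint_left.1 hdisj (Finset.mem_insert_self _ _)), hD]
  simp only [degE_insert_eq_one_iff ha hb h]
  by_cases hv : v = a ∨ v = b
  · rcases hv with rfl | rfl <;> simp [*]
  · rw [not_or] at hv
    simp [hv]

/-- Either the linear forest is a single path with one end `a`, or there are two further ends that
are joined to each other. -/
lemma exists_partner_or (hP : IsKMatching 2 P) (ha : degE P a = 1) :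
    ∃ b, degE P b = 1 ∧ ConnE P a b ∧ ((∀ v, degE P v = 1 ↔ v = a ∨ v = b) ∨
      ∃ c d, degE P c = 1 ∧ degE P d = 1 ∧ c ≠ d ∧ c ≠ a ∧ d ≠ a ∧ c ≠ b ∧ d ≠ b ∧
        ¬ ConnE P a c ∧ ¬ ConnE P a d) := by
  obtain ⟨b, hb, hab⟩ := exists_connE hP ha
  refine ⟨b, hb, hab, ?_⟩
  by_cases h : ∃ c, degE P c = 1 ∧ c ≠ a ∧ c ≠ b
  · obtain ⟨c, hc, hca, hcb⟩ := h
    obtain ⟨d, hd, hcd⟩ := exists_connE hP hc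
    have hda : d ≠ a := by
      rintro rfl
      exact hcb (hcd.symm.unique hP ha hc hb hab)
    have hdb : d ≠ b := by
      rintro rfl
      exact hca (hcd.symm.unique hP hb hc ha hab.symm)
    exact Or.inr ⟨c, d, hc, hd, hcd.ne, hca, hda, hcb, hdb,
      fun h => hcb (h.unique hP ha hc hb hab), fun h => hdb (h.unique hP ha hd hb hab)⟩
  · push Not at h
    refine Or.inl fun v => ⟨fun hv => ?_, ?_⟩
    · by_cases hva : v = a
      · exact Or.inl hva
      · exact Or.inr (h v hv hva)
    · rintro (rfl | rfl) <;> assumption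

/-- Two linear forests with the same ends can be completed to cycles by the same edges. -/
lemma exists_common_completion (hP : IsLinearForestE P) (hQ : IsLinearForestE Q)
    (hPc : 2 ≤ P.card) (hQc : 2 ≤ Q.card) (hPQ : ∀ v, degE P v = 1 ↔ degE Q v = 1) :
    ∃ A, Disjoint P A ∧ Disjoint Q A ∧ IsCycleE (P ∪ A) ∧ IsCycleE (Q ∪ A) ∧
      ∀ v, degE A v = if degE P v = 1 then 1 else 0 := by
  induction hn : (endsE P).card using Nat.strong_induction_on generalizing P Q with
  | _ n ih =>
  obtain ⟨a, ha⟩ : ∃ a, degE P a = 1 := by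
    by_contra! hcon
    have := hP.2.eq_empty hP.1.1 subset_rfl fun v => by
      have := hcon v
      have := hP.1.2 v
      lia
    simp [this] at hPc
  have haQ := (hPQ a).1 ha
  obtain ⟨b, hb, hab, h | ⟨c, d, hc, hd, hcd, hca, hda, -, -, hac, had⟩⟩ :=
    exists_partner_or hP.1 ha
  · obtain ⟨h1, h2⟩ := hP.isCycleE_insert hab.ne h hPc
    obtain ⟨h3, h4⟩ := hQ.isCycleE_insert hab.ne (fun v => (hPQ v).symm.trans (h v)) hQc
    refine ⟨{s(a, b)}, by simpa using h1, by simpa using h3, ?_, ?_, fun v => ?_⟩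
    · rwa [Finset.union_comm, ← Finset.insert_eq]
    · rwa [Finset.union_comm, ← Finset.insert_eq]
    · simp only [degE_singleton, Sym2.mem_iff, h]
  · obtain ⟨x, hx, hxa, hPx, hQx⟩ :
        ∃ x, degE P x = 1 ∧ x ≠ a ∧ ¬ ConnE P a x ∧ ¬ ConnE Q a x := by
      by_cases hQac : ConnE Q a c
      · exact ⟨d, hd, hda, had, fun h =>
          hcd (hQac.unique hQ.1 haQ ((hPQ c).1 hc) ((hPQ d).1 hd) h)⟩
      · exact ⟨c, hc, hca, hac, hQac⟩
    have hxQ := (hPQ x).1 hx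
    have heP : s(a, x) ∉ P := fun he => hPx (connE_of_mem hxa.symm he)
    have heQ : s(a, x) ∉ Q := fun he => hQx (connE_of_mem hxa.symm he)
    obtain ⟨A, h1, h2, h3, h4, h5⟩ := ih _ (hn ▸ card_endsE_insert_lt ha hx heP)
      (hP.insert_edge hxa.symm ha hx hPx) (hQ.insert_edge hxa.symm haQ hxQ hQx)
      (hPc.trans (Finset.card_le_card (Finset.subset_insert _ _)))
      (hQc.trans (Finset.card_le_card (Finset.subset_insert _ _)))
      (fun v => by
        rw [degE_insert_eq_one_iff ha hx heP, degE_insert_eq_one_iff haQ hxQ heQ, hPQ]) rfl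
    refine ⟨insert s(a, x) A, ?_, ?_, ?_, ?_, degE_insert_completion ha hx heP h1 h5⟩
    · exact Finset.disjoint_insert_right.2 ⟨heP, h1.mono_left (Finset.subset_insert _ _)⟩
    · exact Finset.disjoint_insert_right.2 ⟨heQ, h2.mono_left (Finset.subset_insert _ _)⟩
    · rwa [Finset.union_insert, ← Finset.insert_union]
    · rwa [Finset.union_insert, ← Finset.insert_union]

/-- A linear forest `P` can be completed to a cycle by edges that leave `Q` a linear forest, provided
that some path of `Q` has exactly one end among the ends of `P`. -/
lemma exists_completion_of_crossing (hP : IsLinearForestE P) (hQ : IsLinearForestE Q)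
    (hPc : 2 ≤ P.card) (hPQ : ∀ v, degE P v = 1 → degE Q v = 1) (ha : degE P a = 1)
    (hQa : ∀ v, degE P v = 1 → ¬ ConnE Q a v) :
    ∃ B, Disjoint P B ∧ Disjoint Q B ∧ IsCycleE (P ∪ B) ∧ IsLinearForestE (Q ∪ B) ∧
      ∀ v, degE B v = if degE P v = 1 then 1 else 0 := by
  induction hn : (endsE P).card using Nat.strong_induction_on generalizing P Q a with
  | _ n ih =>
  have haQ := hPQ a ha
  obtain ⟨b, hb, hab, h | ⟨c, d, hc, hd, hcd, hca, hda, hcb, hdb, hac, had⟩⟩ :=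
    exists_partner_or hP.1 ha
  · obtain ⟨h1, h2⟩ := hP.isCycleE_insert hab.ne h hPc
    refine ⟨{s(a, b)}, by simpa using h1, ?_, ?_, ?_, fun v => ?_⟩
    · rw [Finset.disjoint_singleton_right]
      exact fun he => hQa b hb (connE_of_mem hab.ne he)
    · rwa [Finset.union_comm, ← Finset.insert_eq]
    · rw [Finset.union_comm, ← Finset.insert_eq]
      exact hQ.insert_edge hab.ne haQ (hPQ b hb) (hQa b hb)
    · simp only [degE_singleton, Sym2.mem_iff, h]
  · obtain ⟨x, y, hx, hy, hxa, hya, hyx, hPx, hQy⟩ : ∃ x y, degE P x = 1 ∧ degE P y = 1 ∧ x ≠ a ∧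
        y ≠ a ∧ y ≠ x ∧ ¬ ConnE P a x ∧
        ∀ v, degE P v = 1 → v ≠ a → v ≠ x → ¬ ConnE (insert s(a, x) Q) y v := by
      by_cases hz : ∃ x z, degE P x = 1 ∧ degE P z = 1 ∧ x ≠ a ∧ ¬ ConnE P a x ∧ ConnE Q x z
      · obtain ⟨x, z, hx, hz, hxa, hPx, hxz⟩ := hz
        have hza : z ≠ a := by rintro rfl; exact hQa x hx hxz.symm
        refine ⟨x, z, hx, hz, hxa, hza, hxz.ne.symm, hPx, fun v hv hva hvx hcon => ?_⟩
        rcases hcon.of_insert hQ.1 haQ (hPQ x hx) (hPQ z hz) (hPQ v hv) hza.symm hva.symm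
          hxz.ne hvx.symm with h | ⟨h, -⟩ | ⟨-, h⟩
        · exact hvx (hxz.symm.unique hQ.1 (hPQ z hz) (hPQ x hx) (hPQ v hv) h).symm
        · exact hQa z hz h.symm
        · exact hQa v hv h.symm
      · push Not at hz
        refine ⟨c, d, hc, hd, hca, hda, hcd.symm, hac, fun v hv hva hvc hcon => ?_⟩
        rcases hcon.of_insert hQ.1 haQ (hPQ c hc) (hPQ d hd) (hPQ v hv) hda.symm hva.symm
          hcd hvc.symm with h | ⟨h, -⟩ | ⟨-, h⟩
        · exact hz d v hd hv hda had h
        · exact hQa d hd h.symm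
        · exact hQa v hv h.symm
    have hxQ := hPQ x hx
    have heP : s(a, x) ∉ P := fun he => hPx (connE_of_mem hxa.symm he)
    have heQ : s(a, x) ∉ Q := fun he => hQa x hx (connE_of_mem hxa.symm he)
    obtain ⟨B, h1, h2, h3, h4, h5⟩ := ih _ (hn ▸ card_endsE_insert_lt ha hx heP)
      (hP.insert_edge hxa.symm ha hx hPx) (hQ.insert_edge hxa.symm haQ hxQ (hQa x hx))
      (hPc.trans (Finset.card_le_card (Finset.subset_insert _ _)))
      (fun v => by
        rw [degE_insert_eq_one_iff ha hx heP, degE_insert_eq_one_iff haQ hxQ heQ]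
        exact fun h => ⟨hPQ v h.1, h.2⟩)
      ((degE_insert_eq_one_iff ha hx heP y).2 ⟨hy, hya, hyx⟩)
      (fun v hv => by
        rw [degE_insert_eq_one_iff ha hx heP] at hv
        exact hQy v hv.1 hv.2.1 hv.2.2) rfl
    refine ⟨insert s(a, x) B, ?_, ?_, ?_, ?_, degE_insert_completion ha hx heP h1 h5⟩
    · exact Finset.disjoint_insert_right.2 ⟨heP, h1.mono_left (Finset.subset_insert _ _)⟩
    · exact Finset.disjoint_insert_right.2 ⟨heQ, h2.mono_left (Finset.subset_insert _ _)⟩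
    · rwa [Finset.union_insert, ← Finset.insert_union]
    · rwa [Finset.union_insert, ← Finset.insert_union]

lemma exists_pair_of_degE_eq_two (h : degE F a = 2) :
    ∃ b c, b ≠ c ∧ s(a, b) ∈ F ∧ s(a, c) ∈ F := by
  obtain ⟨e, e', hne, hee⟩ := Finset.card_eq_two.1 h
  have he : e ∈ F.filter (fun e => a ∈ e) := by simp [hee]
  have he' : e' ∈ F.filter (fun e => a ∈ e) := by simp [hee]
  obtain ⟨he, b, rfl⟩ := Finset.mem_filter.1 he
  obtain ⟨he', c, rfl⟩ := Finset.mem_filter.1 he'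
  exact ⟨b, c, fun h => hne (h ▸ rfl), he, he'⟩

/-- Edges can be moved from a 2-factor `S` to `T` until both become linear forests, without touching
the cycles of `S` that already lost an edge. -/
lemma exists_transfer {S T : Finset (Sym2 V)} (hS : IsKFactor 2 S)
    (hT : ∀ v, v ≠ b → degE T v = 1) (hab : s(a, b) ∈ S) (hbc : s(b, c) ∈ S)
    (hcd : s(c, d) ∈ F) (hFS : F ⊆ S) (hFT : Disjoint F T) (hTF : IsLinearForestE (T ∪ F))
    (haF : degE F a = 0) :
    ∃ F', F ⊆ F' ∧ F' ⊆ S ∧ Disjoint F' T ∧ IsLinearForestE (T ∪ F') ∧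
      IsLinearForestE (S \ F') ∧ degE F' a = 0 := by
  induction hn : (S \ F).card using Nat.strong_induction_on generalizing F with
  | _ n ih =>
  by_cases hac : AcyclicE (S \ F)
  · exact ⟨F, subset_rfl, hFS, hFT, hTF,
      ⟨IsKMatching.mono ⟨hS.1, fun v => (hS.2 v).le⟩ Finset.sdiff_subset, hac⟩, haF⟩
  unfold AcyclicE at hac
  push Not at hac
  obtain ⟨C, hC, hcyc⟩ := hac
  have hCS : C ⊆ S := hC.trans Finset.sdiff_subset
  have hfull : ∀ v e e', e ∈ C → v ∈ e → e' ∈ S → v ∈ e' → e' ∈ C := by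
    intro v e e' he hv he' hv'
    have h1 := degE_pos.2 ⟨e, he, hv⟩
    refine mem_of_degE_eq hCS ?_ he' hv'
    rw [hS.2]
    have := hcyc.isTwoRegularE v
    lia
  have hbC : ∀ e ∈ C, b ∉ e := by
    intro e he hbe
    have h1 := hfull b e s(b, c) he hbe hbc (by simp)
    have h2 := hfull c _ s(c, d) h1 (by simp) (hFS hcd) (by simp)
    exact (Finset.mem_sdiff.1 (hC h2)).2 hcd
  have haC : ∀ e ∈ C, a ∉ e := fun e he hae =>
    hbC _ (hfull a e s(a, b) he hae hab (by simp)) (by simp)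
  have hdeg : ∀ e ∈ C, ∀ v ∈ e, degE (T ∪ F) v = 1 := by
    intro e he v hv
    rw [degE_union hFT.symm, hT v (by rintro rfl; exact hbC e he hv), degE_eq_zero.2]
    intro e' he' hv'
    exact (Finset.mem_sdiff.1 (hC (hfull v e e' he hv (hFS he') hv'))).2 he'
  obtain ⟨e, he⟩ := hcyc.nonempty
  obtain ⟨x, y, hxy, hxy'⟩ : ∃ x y, s(x, y) ∈ C ∧ ¬ ConnE (T ∪ F) x y := by
    induction e with
    | h x w =>
    have hx : degE C x = 2 := by
      have h1 := degE_pos.2 ⟨_, he, Sym2.mem_mk_left x w⟩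
      have h2 := hcyc.isTwoRegularE x
      lia
    obtain ⟨y, z, hyz, hy, hz⟩ := exists_pair_of_degE_eq_two hx
    by_cases hc : ConnE (T ∪ F) x y
    · exact ⟨x, z, hz, fun hc' => hyz (hc.unique hTF.1 (hdeg _ hy x (by simp))
        (hdeg _ hy y (by simp)) (hdeg _ hz z (by simp)) hc')⟩
    · exact ⟨x, y, hy, hc⟩
  have hne : x ≠ y := fun h => hS.1 _ (hCS hxy) (by simpa using h)
  have hnotin : s(x, y) ∉ T ∪ F := fun h => hxy' (connE_of_mem hne h)
  rw [Finset.mem_union, not_or] at hnotin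
  obtain ⟨F', h1, h2, h3, h4, h5, h6⟩ := ih (S \ insert s(x, y) F).card
    (hn ▸ Finset.card_lt_card ⟨Finset.sdiff_subset_sdiff subset_rfl (Finset.subset_insert _ _),
      fun h => by simpa using h (hC hxy)⟩)
    (Finset.mem_insert_of_mem hcd) (Finset.insert_subset (hCS hxy) hFS)
    (Finset.disjoint_insert_left.2 ⟨hnotin.1, hFT⟩)
    (by
      rw [Finset.union_insert]
      exact hTF.insert_edge hne (hdeg _ hxy x (by simp)) (hdeg _ hxy y (by simp)) hxy')
    (by rw [degE_insert hnotin.2, haF, if_neg (haC _ hxy)]) rfl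
  exact ⟨F', (Finset.subset_insert _ _).trans h1, h2, h3, h4, h5, h6⟩

lemma IsCycleE.simpleE (h : IsCycleE F) : SimpleE F := by
  obtain ⟨m, hm, f, hinj, rfl⟩ := h
  intro e he
  obtain ⟨i, hi, rfl⟩ := Finset.mem_image.1 he
  rw [Finset.mem_range] at hi
  rw [Sym2.mk_isDiag_iff]
  intro h
  have h1 := hinj _ hi _ (Nat.mod_lt _ (by lia)) h
  rcases Nat.lt_or_ge (i + 1) m with h2 | h2
  · rw [Nat.mod_eq_of_lt h2] at h1
    lia
  · rw [show i + 1 = m by lia, Nat.mod_self] at h1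
    lia

lemma IsKFactor.degE_eq_zero_or_of_isCycleE_ne (hF : IsKFactor 2 F) (hD : IsCycleE D)
    (hDF : D ⊆ F) (hE : IsCycleE E) (hEF : E ⊆ F) (hne : D ≠ E) (v : V) :
    degE D v = 0 ∨ degE E v = 0 := by
  by_contra! hcon
  have hle := degE_mono (E := D ∩ E) (F := D) Finset.inter_subset_left
  have hinter : ∀ v, degE D v = 2 → degE (D ∩ E) v = degE E v := fun v hv =>
    degE_inter_of_degE_eq hDF hEF (by rw [hF.2, hv])
  have h2 : IsTwoRegularE (D ∩ E) := by
    intro v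
    rcases hD.isTwoRegularE v with h | h
    · have := hle v
      lia
    · rw [hinter v h]
      exact hE.isTwoRegularE v
  have hn : (D ∩ E).Nonempty := by
    have h3 := hinter v ((hD.isTwoRegularE v).resolve_left hcon.1)
    obtain ⟨e, he, -⟩ := degE_pos.1 (show 0 < degE (D ∩ E) v by lia)
    exact ⟨e, he⟩
  exact hne ((hD.eq_of_subset Finset.inter_subset_left h2 hn).symm.trans
    (hE.eq_of_subset Finset.inter_subset_right h2 hn))

/-- Vertices in different cycles of a 2-factor are not connected. -/
lemma IsKFactor.not_connE (hF : IsKFactor 2 F) (hCF : D ⊆ F) (hC : IsTwoRegularE D)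
    (ha : degE D a ≠ 0) (hb : degE D b = 0) : ¬ ConnE F a b := by
  rintro ⟨E, hE, hab, hEa, hEb, hE'⟩
  have hinter : ∀ v, degE D v = 2 → degE (D ∩ E) v = degE E v := fun v hv =>
    degE_inter_of_degE_eq hCF hE (by rw [hF.2, hv])
  have key := even_degE_of_forall_ne (F := D ∩ E) (a := a)
    (hF.1.mono (Finset.inter_subset_left.trans hCF)) fun v hv => by
      rcases hC v with h | h
      · have := degE_mono (E := D ∩ E) (F := D) Finset.inter_subset_left v
        simp [show degE (D ∩ E) v = 0 by lia]
      · rw [hinter v h]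
        rcases hE' v hv (by rintro rfl; lia) with h | h <;> simp [h]
  rw [hinter a ((hC a).resolve_left ha), hEa] at key
  exact absurd key (by decide)

lemma disjoint_of_degE (h : ∀ v, degE D v = 0 ∨ degE E v = 0) : Disjoint D E := by
  rw [Finset.disjoint_left]
  intro e hD hE
  induction e with
  | h a b =>
    rcases h a with h | h
    · exact degE_eq_zero.1 h _ hD (by simp)
    · exact degE_eq_zero.1 h _ hE (by simp)

lemma IsKMatching.isLinearForestE (h : IsKMatching 1 F) : IsLinearForestE F := by
  refine ⟨⟨h.1, fun v => (h.2 v).trans one_le_two⟩, fun C hC hcyc => ?_⟩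
  have : ∀ v, degE C v = 0 := fun v => by
    have h1 := hcyc.isTwoRegularE v
    have h2 := degE_mono hC v
    have h3 := h.2 v
    lia
  exact hcyc.nonempty.ne_empty (eq_empty_of_degE this)

lemma IsKMatching.mem_of_connE (h : IsKMatching 1 F) (hab : ConnE F a b) : s(a, b) ∈ F := by
  obtain ⟨D, hD, hne, ha, hb, hD'⟩ := hab
  obtain ⟨e, he, hae⟩ := degE_pos.1 (show 0 < degE D a by lia)
  obtain ⟨w, rfl⟩ := hae
  have hw := degE_pos.2 ⟨_, he, Sym2.mem_mk_right a w⟩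
  have hwa : w ≠ a := fun hwa => h.1 _ (hD he) (by simp [hwa])
  have h1 := degE_mono hD w
  have h2 := h.2 w
  by_cases hwb : w = b
  · exact hwb ▸ hD he
  · have := hD' w hwa hwb
    lia

lemma spanningE_of_degE (h : ∀ v, 0 < degE F v) : SpanningE F :=
  Set.eq_univ_of_forall fun v => degE_pos.1 (h v)

lemma SpanningE.mono (h : SpanningE D) (hDE : D ⊆ E) : SpanningE E := by
  refine Set.eq_univ_of_forall fun v => ?_
  obtain ⟨e, he, hv⟩ : v ∈ VsetE D := h ▸ Set.mem_univ v
  exact ⟨e, hDE he, hv⟩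

/-- The two path covers obtained by moving edges including `f` and `s(c, d)` from the 2-factor `S`
to `T`. -/
lemma exists_path_covers {S T : Finset (Sym2 V)} {f : Sym2 V} (hS : IsKFactor 2 S)
    (hT : ∀ v, v ≠ b → degE T v = 1) (hTb : degE T b = 2)
    (habS : s(a, b) ∈ S) (habT : s(a, b) ∈ T) (hbcS : s(b, c) ∈ S) (hbcT : s(b, c) ∈ T)
    (hcd : s(c, d) ∈ S) (hac : a ≠ c) (had : a ≠ d) (hdb : d ≠ b) (hfS : f ∈ S) (hfT : f ∉ T)
    (hfa : a ∉ f) (hfc : c ∉ f) (hfd : d ∉ f) (hTf : IsLinearForestE (insert f T)) :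
    ∃ F, f ∈ F ∧ s(c, d) ∈ F ∧ F ⊆ S ∧ Disjoint F T ∧ IsPathCoverE (T ∪ F) ∧
      IsPathCoverE (S \ F) ∧ degE F a = 0 ∧ degE F b = 0 ∧ ∀ v, degE F v ≤ 1 := by
  have hab : a ≠ b := fun h => hS.1 _ habS (by simpa using h)
  have hbc : b ≠ c := fun h => hS.1 _ hbcS (by simpa using h)
  have hne : c ≠ d := fun h => hS.1 _ hcd (by simpa using h)
  have hd1 : ∀ v, v ≠ b → v ∉ f → degE (insert f T) v = 1 := fun v hv hvf => by
    rw [degE_insert hfT, hT v hv, if_neg hvf]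
  have hconn : ConnE (insert f T) c a := by
    have hnot : s(a, b) ∉ ({s(b, c)} : Finset (Sym2 V)) := by
      simp [hab, hac]
    refine ⟨{s(a, b), s(b, c)}, ?_, hac.symm, ?_, ?_, fun v hvc hva => ?_⟩
    · intro e he
      simp only [Finset.mem_insert, Finset.mem_singleton] at he
      rcases he with rfl | rfl <;> simp [*]
    · simp [degE_insert hnot, degE_singleton, hac.symm, hbc.symm]
    · simp [degE_insert hnot, degE_singleton, hac, hab]
    · by_cases hvb : v = b
      · simp [degE_insert hnot, degE_singleton, hvb]
      · simp [degE_insert hnot, degE_singleton, hvb, hva, hvc]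
  have hnc : ¬ ConnE (insert f T) c d := fun h => had (hconn.unique hTf.1 (hd1 c hbc.symm hfc)
    (hd1 a hab hfa) (hd1 d hdb hfd) h)
  have hlf := hTf.insert_edge hne (hd1 c hbc.symm hfc) (hd1 d hdb hfd) hnc
  have hcdf : s(c, d) ∉ insert f T := fun h => hnc (connE_of_mem hne h)
  rw [Finset.mem_insert, not_or] at hcdf
  obtain ⟨F, hFF, hFS, hFT, hTF, hSF, hFa⟩ :=
    exists_transfer (a := a) (b := b) (c := c) (d := d) (F := {s(c, d), f}) hS hT
    habS hbcS (by simp)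
    (by
      intro e he
      simp only [Finset.mem_insert, Finset.mem_singleton] at he
      rcases he with rfl | rfl <;> assumption)
    (by simp [hcdf.2, hfT])
    (by
      rwa [show T ∪ {s(c, d), f} = insert s(c, d) (insert f T) by
        ext; simp only [Finset.mem_union, Finset.mem_insert, Finset.mem_singleton]; tauto])
    (by
      rw [degE_eq_zero]
      intro e he
      simp only [Finset.mem_insert, Finset.mem_singleton] at he
      rcases he with rfl | rfl
      · simp [hac, had]
      · exact hfa)
  have hsum : ∀ v, degE T v + degE F v ≤ 2 := fun v => by
    rw [← degE_union hFT.symm]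
    exact hTF.1.2 v
  have hF1 : ∀ v, degE F v ≤ 1 := fun v => by
    have h1 := hsum v
    by_cases hv : v = b
    · subst hv; lia
    · have := hT v hv; lia
  refine ⟨F, hFF (by simp), hFF (by simp), hFS, hFT, ⟨hTF.1, ?_, hTF.2⟩, ⟨hSF.1, ?_, hSF.2⟩,
    hFa, by have := hsum b; lia, hF1⟩
  · refine spanningE_of_degE fun v => ?_
    rw [degE_union hFT.symm]
    by_cases hv : v = b
    · subst hv; lia
    · have := hT v hv; lia
  · refine spanningE_of_degE fun v => ?_
    have h1 := degE_sdiff_add hFS v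
    have h2 := hF1 v
    have h3 := hS.2 v
    lia

end

set_option maxHeartbeats 1000000 in
theorem stmt13 (ℓ : Sym2 V → ℝ) (hℓ : ∀ e : Sym2 V, 0 ≤ ℓ e)
    (hn : 16 ≤ Fintype.card V)
    (S Cstar Cstar2 T : Finset (Sym2 V)) (v1 v2 v3 v4 : V)
    (f : Sym2 V) (q : V)
    (hS : IsKFactor 2 S) (hSnot : ¬ IsTourE S)
    (hdist : v1 ≠ v2 ∧ v1 ≠ v3 ∧ v1 ≠ v4 ∧ v2 ≠ v3 ∧ v2 ≠ v4 ∧ v3 ≠ v4)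
    (hCstar : IsCycleE Cstar) (hCstarS : Cstar ⊆ S)
    (hP : ({s(v1, v2), s(v2, v3), s(v3, v4)} : Finset (Sym2 V)) ⊆ Cstar)
    (hCstar2 : IsCycleE Cstar2) (hCstar2S : Cstar2 ⊆ S) (hne : Cstar2 ≠ Cstar)
    (hT : IsPathCoverE T) (hTe1 : s(v1, v2) ∈ T) (hTe2 : s(v2, v3) ∈ T)
    (hV1T : V1E T = Set.univ \ {v2})
    (hf : f ∈ Cstar2) (hfT : f ∉ T) (hq : q ∈ f)
    (hins : IsPathCoverE (insert f T)) :
    ∃ S1 S2 T1 T2 : Finset (Sym2 V),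
      IsPathCoverE S1 ∧ IsPathCoverE S2 ∧ IsPathCoverE T1 ∧ IsPathCoverE T2 ∧
      (S1 ∪ T1 = S ∪ T) ∧ (S1 ∩ T1 = S ∩ T) ∧
      (S2 ∪ T2 = S ∪ T) ∧ (S2 ∩ T2 = S ∩ T) ∧
      ∃ A1 A2 B1 B2 : Finset (Sym2 V),
        Disjoint A1 A2 ∧ Disjoint A1 B1 ∧ Disjoint A1 B2 ∧
        Disjoint A2 B1 ∧ Disjoint A2 B2 ∧ Disjoint B1 B2 ∧
        Disjoint S1 A1 ∧ Disjoint S2 A2 ∧ Disjoint T1 B1 ∧ Disjoint T2 B2 ∧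
        IsTourE (S1 ∪ A1) ∧ IsTourE (S2 ∪ A2) ∧
        IsTourE (T1 ∪ B1) ∧ IsTourE (T2 ∪ B2) ∧
        (IsCycleE (A1 ∪ A2 ∪ B1 ∪ B2) ∨
          (∃ C1 C2 : Finset (Sym2 V), IsCycleE C1 ∧ IsCycleE C2 ∧
            Disjoint (VsetE C1) (VsetE C2) ∧ A1 ∪ A2 ∪ B1 ∪ B2 = C1 ∪ C2)) ∧
        VsetE (A1 ∪ A2 ∪ B1 ∪ B2) = Set.univ \ {v2} ∧
        (∃ D : Finset (Sym2 V), IsCycleE D ∧ VsetE D = Set.univ \ {v2} ∧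
          s(q, v3) ∈ D ∧ lenE ℓ (A1 ∪ A2 ∪ B1 ∪ B2) ≤ lenE ℓ D) := by
  obtain ⟨q', rfl⟩ := hq
  obtain ⟨h12, h13, h14, h23, h24, h34⟩ := hdist
  have he12 : s(v1, v2) ∈ Cstar := hP (by simp)
  have he23 : s(v2, v3) ∈ Cstar := hP (by simp)
  have he34 : s(v3, v4) ∈ Cstar := hP (by simp)
  have hTdeg : ∀ v, v ≠ v2 → degE T v = 1 := fun v hv => by
    have : v ∈ V1E T := by rw [hV1T]; simpa using hv
    exact this
  have hT2 : degE T v2 = 2 := by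
    have h1 : degE T v2 ≠ 1 := fun h => by
      have : v2 ∈ V1E T := h
      rw [hV1T] at this
      simp at this
    have h2 := degE_pos.2 ⟨_, hTe1, Sym2.mem_mk_right v1 v2⟩
    have h3 := hT.1.2 v2
    lia
  have hdisjC := hS.degE_eq_zero_or_of_isCycleE_ne hCstar2 hCstar2S hCstar hCstarS hne
  have hpos : ∀ {v e}, e ∈ Cstar → v ∈ e → degE Cstar2 v = 0 := fun he hv =>
    (hdisjC _).resolve_right (degE_pos.2 ⟨_, he, hv⟩).ne'
  have hz1 := hpos he12 (Sym2.mem_mk_left _ _)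
  have hz2 := hpos he12 (Sym2.mem_mk_right _ _)
  have hz3 := hpos he34 (Sym2.mem_mk_left _ _)
  have hz4 := hpos he34 (Sym2.mem_mk_right _ _)
  have hnf : ∀ {v}, degE Cstar2 v = 0 → v ∉ s(q, q') := fun h => degE_eq_zero.1 h _ hf
  have hq0 : degE Cstar2 q ≠ 0 := (degE_pos.2 ⟨_, hf, Sym2.mem_mk_left _ _⟩).ne'
  have hq'0 : degE Cstar2 q' ≠ 0 := (degE_pos.2 ⟨_, hf, Sym2.mem_mk_right _ _⟩).ne'
  have hqq' : q ≠ q' := fun h => hins.1.1 _ (Finset.mem_insert_self _ _) (by simpa using h)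
  have hq2 : q ≠ v2 := by rintro rfl; exact hq0 hz2
  have hq3 : q ≠ v3 := by rintro rfl; exact hq0 hz3
  have hq'2 : q' ≠ v2 := by rintro rfl; exact hq'0 hz2
  have hq'3 : q' ≠ v3 := by rintro rfl; exact hq'0 hz3
  have hq'1 : q' ≠ v1 := by rintro rfl; exact hq'0 hz1
  obtain ⟨v0, hv0, h02⟩ : ∃ v0, s(v1, v0) ∈ Cstar ∧ v0 ≠ v2 := by
    have h1 : degE Cstar v1 = 2 := (hCstar.isTwoRegularE v1).resolve_left
      (degE_pos.2 ⟨_, he12, Sym2.mem_mk_left _ _⟩).ne'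
    obtain ⟨b, c, hbc, hb, hc⟩ := exists_pair_of_degE_eq_two h1
    by_cases hb2 : b = v2
    · exact ⟨c, hc, fun h => hbc (hb2.trans h.symm)⟩
    · exact ⟨b, hb, hb2⟩
  have h03 : v0 ≠ v3 := by
    rintro rfl
    have h1 : ({s(v1, v0), s(v2, v0), s(v0, v4)} : Finset (Sym2 V)) ⊆
        S.filter (fun e => v0 ∈ e) := by
      intro e he
      simp only [Finset.mem_insert, Finset.mem_singleton] at he
      rcases he with rfl | rfl | rfl <;> simp [hCstarS hv0, hCstarS he23, hCstarS he34]
    have h2 := Finset.card_le_card h1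
    rw [Finset.card_eq_three.2 ⟨s(v1, v0), s(v2, v0), s(v0, v4), by simp [h12, h13],
      by simp [h13, h14], by simp [h23, h24], rfl⟩] at h2
    have h3 : degE S v0 = 2 := hS.2 v0
    unfold degE at h3
    lia
  have hlf : IsLinearForestE (insert s(q, q') T) := ⟨hins.1, hins.2.2⟩
  obtain ⟨F1, hfF1, hcF1, hF1S, hF1T, hcT1, hcS1, hF1a, hF1b, hF1le⟩ :=
    exists_path_covers hS hTdeg hT2 (hCstarS he12) hTe1 (hCstarS he23) hTe2 (hCstarS he34) h13 h14
      h24.symm (hCstar2S hf) hfT (hnf hz1) (hnf hz3) (hnf hz4) hlf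
  have he32 : s(v3, v2) = s(v2, v3) := Sym2.eq_swap
  have he21 : s(v2, v1) = s(v1, v2) := Sym2.eq_swap
  obtain ⟨F2, hfF2, hcF2, hF2S, hF2T, hcT2, hcS2, hF2a, hF2b, hF2le⟩ :=
    exists_path_covers (a := v3) (b := v2) (c := v1) (d := v0) hS hTdeg hT2
      (he32 ▸ hCstarS he23) (he32 ▸ hTe2) (he21 ▸ hCstarS he12) (he21 ▸ hTe1) (hCstarS hv0)
      h13.symm h03.symm h02 (hCstar2S hf) hfT (hnf hz3) (hnf hz1)
      (hnf (hpos hv0 (Sym2.mem_mk_right _ _))) hlf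
  have hone : ∀ {F : Finset (Sym2 V)} {v e}, (∀ v, degE F v ≤ 1) → e ∈ F → v ∈ e →
      degE F v = 1 := fun hle he hv => le_antisymm (hle _) (degE_pos.2 ⟨_, he, hv⟩)
  have hF1q := hone hF1le hfF1 (Sym2.mem_mk_left _ _)
  have hF1q' := hone hF1le hfF1 (Sym2.mem_mk_right _ _)
  have hF1v3 := hone hF1le hcF1 (Sym2.mem_mk_left _ _)
  have hF2q := hone hF2le hfF2 (Sym2.mem_mk_left _ _)
  have hF2q' := hone hF2le hfF2 (Sym2.mem_mk_right _ _)
  have hF2v1 := hone hF2le hcF2 (Sym2.mem_mk_left _ _)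
  have hS1d : ∀ v, degE (S \ F1) v + degE F1 v = 2 := fun v =>
    (degE_sdiff_add hF1S v).trans (hS.2 v)
  have hS2d : ∀ v, degE (S \ F2) v + degE F2 v = 2 := fun v =>
    (degE_sdiff_add hF2S v).trans (hS.2 v)
  have hT1d : ∀ v, degE (T ∪ F1) v = degE T v + degE F1 v := degE_union hF1T.symm
  have hT2d : ∀ v, degE (T ∪ F2) v = degE T v + degE F2 v := degE_union hF2T.symm
  have hne1223 : s(v1, v2) ≠ s(v2, v3) := by simp [h12, h13]
  have hcardT : 2 ≤ T.card := Finset.one_lt_card.2 ⟨_, hTe1, _, hTe2, hne1223⟩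
  have hcardS : ∀ F : Finset (Sym2 V), Disjoint F T → 2 ≤ (S \ F).card := fun F hF =>
    Finset.one_lt_card.2 ⟨_, Finset.mem_sdiff.2 ⟨hCstarS he12, Finset.disjoint_right.1 hF hTe1⟩, _,
      Finset.mem_sdiff.2 ⟨hCstarS he23, Finset.disjoint_right.1 hF hTe2⟩, hne1223⟩
  -- the second pair of tours
  have hncS2 : ¬ ConnE (S \ F2) q' v1 := fun h =>
    hS.not_connE hCstar2S hCstar2.isTwoRegularE hq'0 hz1 (h.mono Finset.sdiff_subset)
  have hS2q' : degE (S \ F2) q' = 1 := by have := hS2d q'; lia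
  have hS2v1 : degE (S \ F2) v1 = 1 := by have := hS2d v1; lia
  have hx2 : s(q', v1) ∉ S \ F2 := fun h => hncS2 (connE_of_mem hq'1 h)
  have hS2lf : IsLinearForestE (insert s(q', v1) (S \ F2)) :=
    IsLinearForestE.insert_edge ⟨hcS2.1, hcS2.2.2⟩ hq'1 hS2q' hS2v1 hncS2
  have hS2card := (hcardS F2 hF2T).trans (Finset.card_le_card (Finset.subset_insert s(q', v1) _))
  obtain ⟨A2', hA2d, -, hA2c, -, hA2deg⟩ :=
    exists_common_completion hS2lf hS2lf hS2card hS2card fun _ => Iff.rfl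
  have hT2lf : IsLinearForestE (T ∪ F2) := ⟨hcT2.1, hcT2.2.2⟩
  have hT2card := hcardT.trans (Finset.card_le_card (Finset.subset_union_left (s₂ := F2)))
  obtain ⟨B2, hB2d, -, hB2c, -, hB2deg⟩ :=
    exists_common_completion hT2lf hT2lf hT2card hT2card fun _ => Iff.rfl
  replace hA2deg := degE_insert_completion hS2q' hS2v1 hx2 hA2d hA2deg
  have hS2A2 : Disjoint (S \ F2) (insert s(q', v1) A2') :=
    Finset.disjoint_insert_right.2 ⟨hx2, hA2d.mono_left (Finset.subset_insert _ _)⟩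
  rw [Finset.insert_union, ← Finset.union_insert] at hA2c
  have hqA2 : s(q', v1) ∈ insert s(q', v1) A2' := Finset.mem_insert_self _ _
  generalize insert s(q', v1) A2' = A2 at hA2deg hA2c hS2A2 hqA2
  replace hA2deg : ∀ v, degE A2 v = degE F2 v := fun v => by
    have h1 := hF2le v
    have h2 := hS2d v
    rw [hA2deg]
    split_ifs <;> lia
  replace hB2deg : ∀ v, degE B2 v + degE F2 v = if v = v2 then 0 else 1 := fun v => by
    have h1 := hF2le v
    have h2 := hT2d v
    rw [hB2deg]
    by_cases hv : v = v2
    · subst hv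
      simp only [if_true]
      rw [if_neg (by lia), hF2b]
    · have := hTdeg v hv
      rw [if_neg hv]
      split_ifs <;> lia
  have hA2B2 : Disjoint A2 B2 := disjoint_of_degE fun v => by
    have h1 := hA2deg v
    have h2 := hB2deg v
    split_ifs at h2 <;> lia
  have hMdeg : ∀ v, degE (A2 ∪ B2) v = if v = v2 then 0 else 1 := fun v => by
    rw [degE_union hA2B2, hA2deg, ← hB2deg, add_comm]
  have hM : IsKMatching 1 (A2 ∪ B2) := by
    refine ⟨fun e he => ?_, fun v => ?_⟩
    · rcases Finset.mem_union.1 he with h | h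
      · exact hA2c.simpleE e (Finset.mem_union_right _ h)
      · exact hB2c.simpleE e (Finset.mem_union_right _ h)
    · rw [hMdeg]
      split_ifs <;> lia
  have hxM : s(q, v3) ∉ A2 ∪ B2 := by
    rw [Finset.mem_union]
    rintro (h | h)
    · exact degE_eq_zero.1 ((hA2deg v3).trans hF2a) _ h (Sym2.mem_mk_right _ _)
    · have h1 := hB2deg q
      rw [if_neg hq2] at h1
      exact degE_eq_zero.1 (show degE B2 q = 0 by lia) _ h (Sym2.mem_mk_left _ _)
  have hMq : degE (A2 ∪ B2) q = 1 := by rw [hMdeg, if_neg hq2]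
  have hMv3 : degE (A2 ∪ B2) v3 = 1 := by rw [hMdeg, if_neg h23.symm]
  have hQ : IsLinearForestE (insert s(q, v3) (A2 ∪ B2)) :=
    hM.isLinearForestE.insert_edge hq3 hMq hMv3 fun h => hxM (hM.mem_of_connE h)
  have hQ1 := degE_insert_eq_one_iff hMq hMv3 hxM
  -- the first pair of tours
  have hT1v1 : degE (T ∪ F1) v1 = 1 := by rw [hT1d, hTdeg v1 h12, hF1a]
  have hT1v : ∀ v, degE (T ∪ F1) v = 1 → v ≠ v2 ∧ degE F1 v = 0 := fun v hv => by
    rw [hT1d] at hv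
    have h1 : v ≠ v2 := by rintro rfl; lia
    have := hTdeg v h1
    exact ⟨h1, by lia⟩
  have hT1Q : ∀ v, degE (T ∪ F1) v = 1 → degE (insert s(q, v3) (A2 ∪ B2)) v = 1 := fun v hv => by
    obtain ⟨h1, h2⟩ := hT1v v hv
    rw [hQ1, hMdeg, if_neg h1]
    refine ⟨rfl, ?_, ?_⟩ <;> rintro rfl <;> lia
  have hcross : ConnE (insert s(q, v3) (A2 ∪ B2)) v1 q' :=
    (connE_of_mem hq'1 (Finset.mem_insert_of_mem (Finset.mem_union_left _ hqA2))).symm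
  obtain ⟨B1, hT1B1, hQB1, hB1c, hQB1lf, hB1deg⟩ :=
    exists_completion_of_crossing ⟨hcT1.1, hcT1.2.2⟩ hQ
      (hcardT.trans (Finset.card_le_card Finset.subset_union_left)) hT1Q hT1v1 fun v hv h => by
        have h1 := hcross.unique hQ.1 (hT1Q _ hT1v1)
          ((hQ1 q').2 ⟨by rw [hMdeg, if_neg hq'2], hqq'.symm, hq'3⟩) (hT1Q v hv) h
        have h2 := (hT1v v hv).2
        subst h1
        lia
  have hncS1 : ¬ ConnE (S \ F1) q v3 := fun h =>
    hS.not_connE hCstar2S hCstar2.isTwoRegularE hq0 hz3 (h.mono Finset.sdiff_subset)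
  have hS1q : degE (S \ F1) q = 1 := by have := hS1d q; lia
  have hS1v3 : degE (S \ F1) v3 = 1 := by have := hS1d v3; lia
  have hx1 : s(q, v3) ∉ S \ F1 := fun h => hncS1 (connE_of_mem hq3 h)
  obtain ⟨A1', hA1d, hQA1, hA1c, hCc, hA1deg⟩ :=
    exists_common_completion (P := insert s(q, v3) (S \ F1))
      (IsLinearForestE.insert_edge ⟨hcS1.1, hcS1.2.2⟩ hq3 hS1q hS1v3 hncS1) hQB1lf
      ((hcardS F1 hF1T).trans (Finset.card_le_card (Finset.subset_insert _ _)))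
      (Finset.one_lt_card.2 ⟨s(q, v3), by simp, s(q', v1), by simp [hqA2],
        by simp [hqq', h13.symm, hq'3.symm]⟩)
      (fun v => by
        rw [degE_insert_eq_one_iff hS1q hS1v3 hx1, degE_union hQB1,
          degE_insert_endpoints hxM, hMdeg, hB1deg, hT1d]
        have h1 := hS1d v
        have h2 := hF1le v
        by_cases hv2 : v = v2
        · subst hv2
          simp only [hq2.symm, h23, hT2, hF1b]
          simp
          lia
        · rw [hTdeg v hv2]
          by_cases hv : v = q ∨ v = v3
          · rcases hv with rfl | rfl
            · simp [hv2, hF1q]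
            · simp [hv2, hF1v3]
          · simp only [hv2, hv, if_false]
            rw [not_or] at hv
            split_ifs <;> simp only [hv, ne_eq, not_false_eq_true, and_true] <;> lia)
  replace hA1deg := degE_insert_completion hS1q hS1v3 hx1 hA1d hA1deg
  have hC : insert s(q, v3) A1' ∪ A2 ∪ B1 ∪ B2 = insert s(q, v3) (A2 ∪ B2) ∪ B1 ∪ A1' := by
    ext e
    simp only [Finset.mem_union, Finset.mem_insert]
    tauto
  have hA1M : Disjoint (insert s(q, v3) A1') (A2 ∪ B2) :=
    Finset.disjoint_insert_left.2 ⟨hxM, (hQA1.mono_left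
      ((Finset.subset_insert _ _).trans Finset.subset_union_left)).symm⟩
  have hMB1 : Disjoint (A2 ∪ B2) B1 := hQB1.mono_left (Finset.subset_insert _ _)
  have hA1B1 : Disjoint (insert s(q, v3) A1') B1 :=
    Finset.disjoint_insert_left.2 ⟨Finset.disjoint_left.1 hQB1 (Finset.mem_insert_self _ _),
      (hQA1.mono_left Finset.subset_union_right).symm⟩
  have hVC : VsetE (insert s(q, v3) A1' ∪ A2 ∪ B1 ∪ B2) = Set.univ \ {v2} := by
    ext v
    change (∃ e ∈ _, v ∈ e) ↔ _
    rw [← degE_pos, show insert s(q, v3) A1' ∪ A2 ∪ B1 ∪ B2 =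
      insert s(q, v3) A1' ∪ (A2 ∪ B2) ∪ B1 by
        ext e; simp only [Finset.mem_union]; tauto,
      degE_union (Finset.disjoint_union_left.2 ⟨hA1B1, hMB1⟩), degE_union hA1M, hMdeg, hA1deg,
      hB1deg, hT1d]
    have h1 := hS1d v
    by_cases hv : v = v2
    · subst hv
      have : degE (S \ F1) v ≠ 1 := by lia
      simp [hT2, hF1b, this]
    · simp only [hv, if_false, Set.mem_sdiff, Set.mem_univ, Set.mem_singleton_iff,
        not_false_eq_true, and_true, iff_true]
      lia
  have hinter : ∀ F : Finset (Sym2 V), F ⊆ S → Disjoint F T →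
      S \ F ∪ (T ∪ F) = S ∪ T ∧ S \ F ∩ (T ∪ F) = S ∩ T := by
    intro F hFS hFT
    constructor <;> ext e
    all_goals
      have h1 := @hFS e
      have h2 : e ∈ F → e ∉ T := fun h => Finset.disjoint_left.1 hFT h
      simp only [Finset.mem_union, Finset.mem_inter, Finset.mem_sdiff]
      tauto
  refine ⟨S \ F1, S \ F2, T ∪ F1, T ∪ F2, hcS1, hcS2, hcT1, hcT2, (hinter F1 hF1S hF1T).1,
    (hinter F1 hF1S hF1T).2, (hinter F2 hF2S hF2T).1, (hinter F2 hF2S hF2T).2,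
    insert s(q, v3) A1', A2, B1, B2, hA1M.mono_right Finset.subset_union_left, hA1B1,
    hA1M.mono_right Finset.subset_union_right, hMB1.mono_left Finset.subset_union_left, hA2B2,
    (hMB1.mono_left Finset.subset_union_right).symm,
    Finset.disjoint_insert_right.2 ⟨hx1, hA1d.mono_left (Finset.subset_insert _ _)⟩, hS2A2, hT1B1,
    hB2d, ⟨?_, hcS1.2.1.mono Finset.subset_union_left⟩,
    ⟨hA2c, hcS2.2.1.mono Finset.subset_union_left⟩,
    ⟨hB1c, hcT1.2.1.mono Finset.subset_union_left⟩,
    ⟨hB2c, hcT2.2.1.mono Finset.subset_union_left⟩, Or.inl (hC ▸ hCc), hVC,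
    _, hC ▸ hCc, hVC, by simp, le_rfl⟩
  rwa [Finset.union_insert, ← Finset.insert_union]
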